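/- Let P be a doubly stochastic ergodic transition matrix on a finite state space of size N, let T be an integer such that m/N ≤ P^T(u,v) ≤ M/N for all states u,v (where 0 < m ≤ 1 ≤ M), and let L be an integer with L ≥ 2·√( (2N/M)·max{A_T, A_T^*} ). Then, for any starting state, the self-intersection count S = ∑_{i=0}^{L} ∑_{j=i+2T}^{L+2T} 1{X_i = X_j} satisfies Pr[S > 0] ≥ m²/(2M²); in particular a collision occurs within L + 2T steps with probability at least m²/(2M²). -/

import Mathlib

open MeasureTheory Finset

/-- The trajectory `X` is (in law) a Markov chain with transition matrix `P` under the
probability measure `μ`. -/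
def IsMarkovTraj {S Ω : Type*} [MeasurableSpace Ω]
    (μ : Measure Ω) (P : Matrix S S ℝ) (X : ℕ → Ω → S) : Prop :=
  ∀ (n : ℕ) (y : ℕ → S),
    (μ {ω | ∀ i ≤ n + 1, X i ω = y i}).toReal
      = P (y n) (y (n + 1)) * (μ {ω | ∀ i ≤ n, X i ω = y i}).toReal

/-- `GreenFn P T u v = ∑_{i=0}^T P^i(u,v)`. -/
noncomputable def GreenFn {S : Type*} [Fintype S] [DecidableEq S]
    (P : Matrix S S ℝ) (T : ℕ) : Matrix S S ℝ :=
  ∑ i ∈ Finset.range (T + 1), P ^ i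

/-- `Acoll P T = max_u ∑_v G_T(u,v)²`. -/
noncomputable def Acoll {S : Type*} [Fintype S] [DecidableEq S]
    (P : Matrix S S ℝ) (T : ℕ) : ℝ :=
  ⨆ u, ∑ v, (GreenFn P T u v) ^ 2

/-- `AcollStar P T = max_u ∑_v G_T(v,u)²`. -/
noncomputable def AcollStar {S : Type*} [Fintype S] [DecidableEq S]
    (P : Matrix S S ℝ) (T : ℕ) : ℝ :=
  ⨆ u, ∑ v, (GreenFn P T v u) ^ 2

/-- The self-intersection count `S = ∑_{i=0}^{L} ∑_{j=i+2T}^{L+2T} 1{X_i = X_j}`. -/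
noncomputable def collCount {S Ω : Type*} [DecidableEq S]
    (X : ℕ → Ω → S) (T L : ℕ) (ω : Ω) : ℝ :=
  ∑ i ∈ Finset.range (L + 1), ∑ j ∈ Finset.Icc (i + 2 * T) (L + 2 * T),
    if X i ω = X j ω then 1 else 0

theorem measureReal_eq_sum_fiber {Ω α : Type*} [MeasurableSpace Ω] (μ : Measure Ω)
    [IsFiniteMeasure μ] [Fintype α] [MeasurableSpace α] [MeasurableSingletonClass α]
    {f : Ω → α} (hf : Measurable f) (p : Ω → Prop) :
    μ.real {ω | p ω} = ∑ a, μ.real {ω | p ω ∧ f ω = a} := by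
  have h := sum_measureReal_preimage_singleton (μ := μ.restrict {ω | p ω}) (f := f) Finset.univ
    (fun a _ => hf (measurableSet_singleton a))
  rw [Finset.coe_univ, Set.preimage_univ, measureReal_restrict_apply MeasurableSet.univ,
    Set.univ_inter] at h
  rw [← h]
  refine Finset.sum_congr rfl fun a _ => ?_
  rw [measureReal_restrict_apply (hf (measurableSet_singleton a))]
  congr 1
  ext ω
  exact and_comm

section MarkovProperty

variable {S Ω : Type*} [Fintype S] [DecidableEq S] [MeasurableSpace S]
  [MeasurableSingletonClass S] [MeasurableSpace Ω] {μ : Measure Ω} [IsProbabilityMeasure μ]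
  {P : Matrix S S ℝ} {X : ℕ → Ω → S}

/-- One-step Markov property for an event `Q` determined by the path up to time `n`. -/
theorem IsMarkovTraj.measureReal_succ (hmarkov : IsMarkovTraj μ P X)
    (hmeas : ∀ n, Measurable (X n)) (n : ℕ) (Q : (ℕ → S) → Prop)
    (hQ : ∀ y z : ℕ → S, (∀ i ≤ n, y i = z i) → Q y → Q z) (u v : S) :
    μ.real {ω | (Q fun i => X i ω) ∧ X n ω = u ∧ X (n + 1) ω = v} =
      P u v * μ.real {ω | (Q fun i => X i ω) ∧ X n ω = u} := by
  have hf : Measurable (fun ω (i : Fin (n + 1)) => X i ω) :=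
    measurable_pi_lambda _ fun i => hmeas i
  rw [measureReal_eq_sum_fiber μ hf, measureReal_eq_sum_fiber μ hf (fun ω => _ ∧ X n ω = u),
    Finset.mul_sum]
  refine Finset.sum_congr rfl fun y _ => ?_
  obtain ⟨z, hz, hzv⟩ : ∃ z : ℕ → S, (∀ i : Fin (n + 1), z i = y i) ∧ z (n + 1) = v :=
    ⟨fun i => if h : i < n + 1 then y ⟨i, h⟩ else v, fun i => dif_pos i.2, by simp⟩
  have hfib : ∀ ω, (fun i : Fin (n + 1) => X i ω) = y ↔ ∀ i ≤ n, X i ω = z i := by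
    intro ω
    rw [funext_iff]
    constructor
    · intro h i hi
      rw [h ⟨i, by omega⟩, ← hz]
    · intro h i
      rw [h i (by omega), hz]
  simp only [hfib]
  by_cases hgood : Q z ∧ z n = u
  · obtain ⟨hQz, hzu⟩ := hgood
    convert hmarkov n z using 2
    · simp only [Measure.real]
      congr 2
      ext ω
      constructor
      · rintro ⟨⟨-, -, h1⟩, h2⟩ i hi
        rcases Nat.le_succ_iff.1 hi with h | rfl
        · exact h2 i h
        · rw [h1, hzv]
      · intro h
        exact ⟨⟨hQ z _ (fun i hi => (h i (by omega)).symm) hQz, by rw [h n (by omega), hzu],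
          by rw [h _ le_rfl, hzv]⟩, fun i hi => h i (by omega)⟩
    · rw [hzu, hzv]
    · simp only [Measure.real]
      congr 2
      ext ω
      constructor
      · exact fun h => h.2
      · intro h
        exact ⟨⟨hQ z _ (fun i hi => (h i hi).symm) hQz, by rw [h n le_rfl, hzu]⟩, h⟩
  · have hempty : {ω | ((Q fun i => X i ω) ∧ X n ω = u) ∧ ∀ i ≤ n, X i ω = z i} = ∅ := by
      ext ω
      simp only [Set.mem_ofPred_eq, Set.mem_empty_iff_false, iff_false]
      rintro ⟨⟨h1, h2⟩, h3⟩
      exact hgood ⟨hQ _ z h3 h1, by rw [← h3 n le_rfl, h2]⟩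
    have hempty' : {ω | ((Q fun i => X i ω) ∧ X n ω = u ∧ X (n + 1) ω = v) ∧
        ∀ i ≤ n, X i ω = z i} = ∅ :=
      Set.eq_empty_of_subset_empty fun ω h => hempty ▸ ⟨⟨h.1.1, h.1.2.1⟩, h.2⟩
    rw [hempty, hempty']
    simp

/-- Multi-step Markov property for an event `Q` determined by the path up to time `n`. -/
theorem IsMarkovTraj.measureReal_add (hmarkov : IsMarkovTraj μ P X)
    (hmeas : ∀ n, Measurable (X n)) (n k : ℕ) (Q : (ℕ → S) → Prop)
    (hQ : ∀ y z : ℕ → S, (∀ i ≤ n, y i = z i) → Q y → Q z) (u v : S) :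
    μ.real {ω | ((Q fun i => X i ω) ∧ X n ω = u) ∧ X (n + k) ω = v} =
      μ.real {ω | (Q fun i => X i ω) ∧ X n ω = u} * (P ^ k) u v := by
  induction k generalizing v with
  | zero =>
    by_cases huv : u = v
    · subst huv
      simp
    · rw [pow_zero, Matrix.one_apply_ne huv, mul_zero]
      convert measureReal_empty (μ := μ)
      ext ω
      simp only [Set.mem_ofPred_eq, Set.mem_empty_iff_false, iff_false]
      rintro ⟨⟨-, h1⟩, h2⟩
      exact huv (h1.symm.trans h2)
  | succ k ih =>
    rw [measureReal_eq_sum_fiber μ (hmeas (n + k)), pow_succ, Matrix.mul_apply, Finset.mul_sum]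
    refine Finset.sum_congr rfl fun w _ => ?_
    have h := hmarkov.measureReal_succ hmeas (n + k) (fun y => Q y ∧ y n = u)
      (fun y z hyz hy => ⟨hQ y z (fun i hi => hyz i (by omega)) hy.1,
        by rw [← hyz n (by omega), hy.2]⟩) w v
    rw [ih w] at h
    rw [← mul_assoc, mul_comm _ (P w v), ← h]
    congr 1
    ext ω
    simp only [Set.mem_ofPred_eq, ← add_assoc]
    tauto

theorem IsMarkovTraj.measureReal_one (hmarkov : IsMarkovTraj μ P X)
    (hmeas : ∀ n, Measurable (X n)) {x₀ : S} (hstart : μ {ω | X 0 ω = x₀} = 1)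
    (a : ℕ) (x : S) : μ.real {ω | X a ω = x} = (P ^ a) x₀ x := by
  have h := hmarkov.measureReal_add hmeas 0 a (fun _ => True) (fun _ _ _ _ => trivial) x₀ x
  simp only [true_and, zero_add] at h
  have h1 : μ.real {ω | X 0 ω = x₀} = 1 := by simp [Measure.real, hstart]
  rw [h1, one_mul] at h
  rw [← h]
  have hae : ∀ᵐ ω ∂μ, X 0 ω = x₀ := (prob_compl_eq_zero_iff
    (hmeas 0 (measurableSet_singleton x₀))).2 hstart
  refine measureReal_congr ?_
  filter_upwards [hae] with ω hω
  exact propext ⟨fun h => ⟨hω, h⟩, fun h => h.2⟩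

theorem IsMarkovTraj.measureReal_two (hmarkov : IsMarkovTraj μ P X)
    (hmeas : ∀ n, Measurable (X n)) {x₀ : S} (hstart : μ {ω | X 0 ω = x₀} = 1)
    {a b : ℕ} (hab : a ≤ b) (x y : S) :
    μ.real {ω | X a ω = x ∧ X b ω = y} = (P ^ a) x₀ x * (P ^ (b - a)) x y := by
  have h := hmarkov.measureReal_add hmeas a (b - a) (fun _ => True) (fun _ _ _ _ => trivial) x y
  simpa only [true_and, Nat.add_sub_cancel' hab, hmarkov.measureReal_one hmeas hstart] using h

theorem IsMarkovTraj.measureReal_four (hmarkov : IsMarkovTraj μ P X)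
    (hmeas : ∀ n, Measurable (X n)) {x₀ : S} (hstart : μ {ω | X 0 ω = x₀} = 1)
    {a b c d : ℕ} (hab : a ≤ b) (hbc : b ≤ c) (hcd : c ≤ d) (x y z w : S) :
    μ.real {ω | ((X a ω = x ∧ X b ω = y) ∧ X c ω = z) ∧ X d ω = w} =
      (P ^ a) x₀ x * (P ^ (b - a)) x y * (P ^ (c - b)) y z * (P ^ (d - c)) z w := by
  have h₁ := hmarkov.measureReal_add hmeas b (c - b) (fun y => y a = x)
    (fun y z h hy => by rw [← h a hab, hy]) y z
  have h₂ := hmarkov.measureReal_add hmeas c (d - c) (fun t => t a = x ∧ t b = y)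
    (fun y z h hy => ⟨by rw [← h a (by omega), hy.1], by rw [← h b hbc, hy.2]⟩) z w
  simp only [Nat.add_sub_cancel' hbc, Nat.add_sub_cancel' hcd] at h₁ h₂
  rw [h₂, h₁, hmarkov.measureReal_two hmeas hstart hab]

end MarkovProperty

section StochasticMatrix

variable {S : Type*} [Fintype S] [DecidableEq S] {P : Matrix S S ℝ}

theorem pow_apply_le_of_le (hP : P ∈ doublyStochastic ℝ S) {T n : ℕ} (hTn : T ≤ n) {q : ℝ}
    (hq : ∀ u v, (P ^ T) u v ≤ q) (u v : S) : (P ^ n) u v ≤ q := by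
  have hPn := pow_mem hP (n - T)
  rw [← Nat.sub_add_cancel hTn, pow_add, Matrix.mul_apply]
  calc ∑ w, (P ^ (n - T)) u w * (P ^ T) w v
      ≤ ∑ w, (P ^ (n - T)) u w * q := Finset.sum_le_sum fun w _ =>
        mul_le_mul_of_nonneg_left (hq w v) (nonneg_of_mem_doublyStochastic hPn)
    _ = q := by rw [← Finset.sum_mul, sum_row_of_mem_doublyStochastic hPn, one_mul]

theorem le_pow_apply_of_le (hP : P ∈ doublyStochastic ℝ S) {T n : ℕ} (hTn : T ≤ n) {q : ℝ}
    (hq : ∀ u v, q ≤ (P ^ T) u v) (u v : S) : q ≤ (P ^ n) u v := by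
  have hPn := pow_mem hP (n - T)
  rw [← Nat.sub_add_cancel hTn, pow_add, Matrix.mul_apply]
  calc q = ∑ w, (P ^ (n - T)) u w * q := by
        rw [← Finset.sum_mul, sum_row_of_mem_doublyStochastic hPn, one_mul]
    _ ≤ ∑ w, (P ^ (n - T)) u w * (P ^ T) w v := Finset.sum_le_sum fun w _ =>
        mul_le_mul_of_nonneg_left (hq w v) (nonneg_of_mem_doublyStochastic hPn)

/-- The transition probability from time `a` to time `b`, truncated to lags `b - a ∈ [0, T]`. -/
def truncKernel (P : Matrix S S ℝ) (T a b : ℕ) (u v : S) : ℝ :=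
  if a ≤ b ∧ b ≤ a + T then (P ^ (b - a)) u v else 0

theorem truncKernel_nonneg (hP : P ∈ doublyStochastic ℝ S) (T a b : ℕ) (u v : S) :
    0 ≤ truncKernel P T a b u v := by
  unfold truncKernel
  split_ifs
  exacts [nonneg_of_mem_doublyStochastic (pow_mem hP _), le_rfl]

theorem sum_le_greenFn (hP : P ∈ doublyStochastic ℝ S) (T : ℕ) (s : Finset ℕ) (f : ℕ → ℕ)
    (p : ℕ → Prop) [DecidablePred p] (hf : Set.InjOn f {b | p b}) (hp : ∀ b, p b → f b ≤ T)
    (u v : S) : ∑ b ∈ s, (if p b then (P ^ f b) u v else 0) ≤ GreenFn P T u v := by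
  rw [← Finset.sum_filter, GreenFn, Matrix.sum_apply]
  rw [← Finset.sum_image (s := s.filter p) (g := f) (f := fun i => (P ^ i) u v)
    fun a ha b hb h => hf (by simpa using (Finset.mem_filter.1 ha).2)
      (by simpa using (Finset.mem_filter.1 hb).2) h]
  refine Finset.sum_le_sum_of_subset_of_nonneg (fun i hi => ?_)
    fun i _ _ => nonneg_of_mem_doublyStochastic (pow_mem hP _)
  obtain ⟨b, hb, rfl⟩ := Finset.mem_image.1 hi
  exact Finset.mem_range.2 (Nat.lt_succ_of_le (hp b (Finset.mem_filter.1 hb).2))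

theorem sum_truncKernel_right_le (hP : P ∈ doublyStochastic ℝ S) (T a : ℕ) (s : Finset ℕ)
    (u v : S) : ∑ b ∈ s, truncKernel P T a b u v ≤ GreenFn P T u v :=
  sum_le_greenFn hP T s (fun b => b - a) (fun b => a ≤ b ∧ b ≤ a + T)
    (fun x hx y hy h => by
      simp only [Set.mem_ofPred_eq] at hx hy h
      omega) (fun b hb => by omega) u v

theorem sum_truncKernel_left_le (hP : P ∈ doublyStochastic ℝ S) (T b : ℕ) (s : Finset ℕ)
    (u v : S) : ∑ a ∈ s, truncKernel P T a b u v ≤ GreenFn P T u v :=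
  sum_le_greenFn hP T s (fun a => b - a) (fun a => a ≤ b ∧ b ≤ a + T)
    (fun x hx y hy h => by
      simp only [Set.mem_ofPred_eq] at hx hy h
      omega) (fun b hb => by omega) u v

theorem greenFn_nonneg (hP : P ∈ doublyStochastic ℝ S) (T : ℕ) (u v : S) :
    0 ≤ GreenFn P T u v := by
  rw [GreenFn, Matrix.sum_apply]
  exact Finset.sum_nonneg fun i _ => nonneg_of_mem_doublyStochastic (pow_mem hP _)

theorem sum_greenFn_sq_le_acoll (P : Matrix S S ℝ) (T : ℕ) (u : S) :
    ∑ v, (GreenFn P T u v) ^ 2 ≤ Acoll P T :=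
  le_ciSup (f := fun u => ∑ v, (GreenFn P T u v) ^ 2) (Set.finite_range _).bddAbove u

theorem sum_greenFn_sq_le_acollStar (P : Matrix S S ℝ) (T : ℕ) (u : S) :
    ∑ v, (GreenFn P T v u) ^ 2 ≤ AcollStar P T :=
  le_ciSup (f := fun u => ∑ v, (GreenFn P T v u) ^ 2) (Set.finite_range _).bddAbove u

theorem acoll_pos [Nonempty S] (hP : P ∈ doublyStochastic ℝ S) (T : ℕ) : 0 < Acoll P T := by
  obtain ⟨u⟩ := ‹Nonempty S›
  have h1 : (1 : ℝ) ≤ GreenFn P T u u := by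
    rw [GreenFn, Matrix.sum_apply]
    refine le_trans (by simp) (Finset.single_le_sum (f := fun i => (P ^ i) u u)
      (fun i _ => nonneg_of_mem_doublyStochastic (pow_mem hP _))
      (Finset.mem_range.2 (Nat.succ_pos T)))
  have h2 := Finset.single_le_sum (f := fun v => (GreenFn P T u v) ^ 2)
    (fun v _ => sq_nonneg _) (Finset.mem_univ u)
  have h3 := sum_greenFn_sq_le_acoll P T u
  nlinarith

theorem sum_greenFn_mul_le (P : Matrix S S ℝ) (T : ℕ) (u : S) :
    ∑ v, GreenFn P T u v * (GreenFn P T u v + GreenFn P T v u) ≤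
      2 * max (Acoll P T) (AcollStar P T) := by
  have h : ∑ v, GreenFn P T u v * (GreenFn P T u v + GreenFn P T v u) ≤
      ∑ v, (3 / 2 * (GreenFn P T u v) ^ 2 + 1 / 2 * (GreenFn P T v u) ^ 2) :=
    Finset.sum_le_sum fun v _ => by nlinarith [sq_nonneg (GreenFn P T u v - GreenFn P T v u)]
  rw [Finset.sum_add_distrib, ← Finset.mul_sum, ← Finset.mul_sum] at h
  linarith [sum_greenFn_sq_le_acoll P T u, sum_greenFn_sq_le_acollStar P T u,
    le_max_left (Acoll P T) (AcollStar P T), le_max_right (Acoll P T) (AcollStar P T)]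

/-- The excess term in the bound on the probability that both `X i = X j` and `X k = X l`,
relevant when `i ≤ k ≤ i + T` and `j`, `l` are within distance `T`. -/
def pairExcess (P : Matrix S S ℝ) (T : ℕ) (x₀ : S) (i j k l : ℕ) : ℝ :=
  ∑ u, (P ^ i) x₀ u * ∑ v, truncKernel P T i k u v *
    (truncKernel P T j l u v + truncKernel P T l j v u)

theorem pairExcess_nonneg (hP : P ∈ doublyStochastic ℝ S) (T : ℕ) (x₀ : S) (i j k l : ℕ) :
    0 ≤ pairExcess P T x₀ i j k l :=
  Finset.sum_nonneg fun _ _ => mul_nonneg (nonneg_of_mem_doublyStochastic (pow_mem hP _)) <|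
    Finset.sum_nonneg fun _ _ => mul_nonneg (truncKernel_nonneg hP ..) <|
      add_nonneg (truncKernel_nonneg hP ..) (truncKernel_nonneg hP ..)

theorem sum_pairExcess_le (hP : P ∈ doublyStochastic ℝ S) (T : ℕ) (x₀ : S) (i j : ℕ)
    (s : Finset ℕ) (t : ℕ → Finset ℕ) :
    ∑ k ∈ s, ∑ l ∈ t k, pairExcess P T x₀ i j k l ≤
      2 * max (Acoll P T) (AcollStar P T) := by
  have hswap : ∑ k ∈ s, ∑ l ∈ t k, pairExcess P T x₀ i j k l =
      ∑ u, (P ^ i) x₀ u * ∑ v, ∑ k ∈ s, truncKernel P T i k u v * ∑ l ∈ t k,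
        (truncKernel P T j l u v + truncKernel P T l j v u) := by
    simp only [pairExcess, Finset.mul_sum]
    rw [Finset.sum_congr rfl fun k _ => Finset.sum_comm, Finset.sum_comm]
    refine Finset.sum_congr rfl fun _ _ => ?_
    rw [Finset.sum_congr rfl fun k _ => Finset.sum_comm, Finset.sum_comm]
  rw [hswap]
  calc _ ≤ ∑ u, (P ^ i) x₀ u * (2 * max (Acoll P T) (AcollStar P T)) := by
        refine Finset.sum_le_sum fun u _ => mul_le_mul_of_nonneg_left ?_
          (nonneg_of_mem_doublyStochastic (pow_mem hP _))
        refine le_trans (Finset.sum_le_sum fun v _ => ?_) (sum_greenFn_mul_le P T u)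
        calc _ ≤ ∑ k ∈ s, truncKernel P T i k u v * (GreenFn P T u v + GreenFn P T v u) := by
              refine Finset.sum_le_sum fun k _ => mul_le_mul_of_nonneg_left ?_
                (truncKernel_nonneg hP ..)
              rw [Finset.sum_add_distrib]
              exact add_le_add (sum_truncKernel_right_le hP ..) (sum_truncKernel_left_le hP ..)
          _ ≤ _ := by
              rw [← Finset.sum_mul]
              exact mul_le_mul_of_nonneg_right (sum_truncKernel_right_le hP ..)
                (add_nonneg (greenFn_nonneg hP ..) (greenFn_nonneg hP ..))
    _ = _ := by
        rw [← Finset.sum_mul, sum_row_of_mem_doublyStochastic (pow_mem hP i), one_mul]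

theorem sum_mul_sum_le (hP : P ∈ doublyStochastic ℝ S) (n : ℕ) (x₀ : S) {c : ℝ}
    {W h : S → S → ℝ} (hh : ∀ u, ∑ v, h u v = 1) (hW : ∀ u v, W u v ≤ c * h u v) :
    ∑ u, (P ^ n) x₀ u * ∑ v, W u v ≤ c :=
  calc _ ≤ ∑ u, (P ^ n) x₀ u * c := by
        refine Finset.sum_le_sum fun u _ => mul_le_mul_of_nonneg_left ?_
          (nonneg_of_mem_doublyStochastic (pow_mem hP _))
        refine (Finset.sum_le_sum fun v _ => hW u v).trans_eq ?_
        rw [← Finset.mul_sum, hh, mul_one]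
    _ = c := by rw [← Finset.sum_mul, sum_row_of_mem_doublyStochastic (pow_mem hP n), one_mul]

end StochasticMatrix

section PairCollisions

theorem measureReal_pair_eq {S Ω : Type*} [Fintype S] [MeasurableSpace S]
    [MeasurableSingletonClass S] [MeasurableSpace Ω] {μ : Measure Ω} [IsProbabilityMeasure μ]
    {X : ℕ → Ω → S} (hmeas : ∀ n, Measurable (X n)) (i j k l : ℕ) :
    μ.real {ω | X i ω = X j ω ∧ X k ω = X l ω} =
      ∑ u, ∑ v, μ.real {ω | ((X i ω = u ∧ X k ω = v) ∧ X j ω = u) ∧ X l ω = v} := by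
  rw [measureReal_eq_sum_fiber μ (hmeas i)]
  refine Finset.sum_congr rfl fun u _ => ?_
  rw [measureReal_eq_sum_fiber μ (hmeas k)]
  refine Finset.sum_congr rfl fun v _ => ?_
  congr 1
  ext ω
  simp only [Set.mem_ofPred_eq]
  grind

variable {S Ω : Type*} [Fintype S] [DecidableEq S] [MeasurableSpace S]
  [MeasurableSingletonClass S] [MeasurableSpace Ω] {μ : Measure Ω} [IsProbabilityMeasure μ]
  {P : Matrix S S ℝ} {X : ℕ → Ω → S}

theorem IsMarkovTraj.le_measureReal_collision (hmarkov : IsMarkovTraj μ P X)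
    (hmeas : ∀ n, Measurable (X n)) {x₀ : S} (hstart : μ {ω | X 0 ω = x₀} = 1)
    (hP : P ∈ doublyStochastic ℝ S) {T : ℕ} {q : ℝ} (hq : ∀ u v, q ≤ (P ^ T) u v)
    {i j : ℕ} (hij : i + T ≤ j) : q ≤ μ.real {ω | X i ω = X j ω} := by
  rw [measureReal_eq_sum_fiber μ (hmeas i)]
  calc q = ∑ u, (P ^ i) x₀ u * q := by
        rw [← Finset.sum_mul, sum_row_of_mem_doublyStochastic (pow_mem hP i), one_mul]
    _ ≤ ∑ u, μ.real {ω | X i ω = X j ω ∧ X i ω = u} := by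
        refine Finset.sum_le_sum fun u _ => ?_
        have hset : {ω | X i ω = X j ω ∧ X i ω = u} = {ω | X i ω = u ∧ X j ω = u} := by
          ext ω
          simp only [Set.mem_ofPred_eq]
          grind
        rw [hset, hmarkov.measureReal_two hmeas hstart (by omega)]
        exact mul_le_mul_of_nonneg_left (le_pow_apply_of_le hP (by omega) hq u u)
          (nonneg_of_mem_doublyStochastic (pow_mem hP _))

theorem IsMarkovTraj.measureReal_pair_interleaved (hmarkov : IsMarkovTraj μ P X)
    (hmeas : ∀ n, Measurable (X n)) {x₀ : S} (hstart : μ {ω | X 0 ω = x₀} = 1)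
    {i j k l : ℕ} (hik : i ≤ k) (hkj : k ≤ j) (hjl : j ≤ l) :
    μ.real {ω | X i ω = X j ω ∧ X k ω = X l ω} = ∑ u, (P ^ i) x₀ u *
      ∑ v, (P ^ (k - i)) u v * (P ^ (j - k)) v u * (P ^ (l - j)) u v := by
  simp only [measureReal_pair_eq hmeas, hmarkov.measureReal_four hmeas hstart hik hkj hjl,
    Finset.mul_sum, mul_assoc]

theorem IsMarkovTraj.measureReal_pair_nested (hmarkov : IsMarkovTraj μ P X)
    (hmeas : ∀ n, Measurable (X n)) {x₀ : S} (hstart : μ {ω | X 0 ω = x₀} = 1)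
    {i j k l : ℕ} (hik : i ≤ k) (hkl : k ≤ l) (hlj : l ≤ j) :
    μ.real {ω | X i ω = X j ω ∧ X k ω = X l ω} = ∑ u, (P ^ i) x₀ u *
      ∑ v, (P ^ (k - i)) u v * (P ^ (l - k)) v v * (P ^ (j - l)) v u := by
  have hset : ∀ u v, {ω | ((X i ω = u ∧ X k ω = v) ∧ X j ω = u) ∧ X l ω = v} =
      {ω | ((X i ω = u ∧ X k ω = v) ∧ X l ω = v) ∧ X j ω = u} := fun u v => by
    ext ω
    exact and_right_comm
  simp only [measureReal_pair_eq hmeas, hset,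
    hmarkov.measureReal_four hmeas hstart hik hkl hlj, Finset.mul_sum, mul_assoc]

theorem IsMarkovTraj.measureReal_pair_disjoint (hmarkov : IsMarkovTraj μ P X)
    (hmeas : ∀ n, Measurable (X n)) {x₀ : S} (hstart : μ {ω | X 0 ω = x₀} = 1)
    {i j k l : ℕ} (hij : i ≤ j) (hjk : j ≤ k) (hkl : k ≤ l) :
    μ.real {ω | X i ω = X j ω ∧ X k ω = X l ω} = ∑ u, (P ^ i) x₀ u *
      ∑ v, (P ^ (j - i)) u u * (P ^ (k - j)) u v * (P ^ (l - k)) v v := by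
  have hset : ∀ u v, {ω | ((X i ω = u ∧ X k ω = v) ∧ X j ω = u) ∧ X l ω = v} =
      {ω | ((X i ω = u ∧ X j ω = u) ∧ X k ω = v) ∧ X l ω = v} := fun u v => by
    ext ω
    simp only [Set.mem_ofPred_eq]
    tauto
  simp only [measureReal_pair_eq hmeas, hset,
    hmarkov.measureReal_four hmeas hstart hij hjk hkl, Finset.mul_sum, mul_assoc]

theorem mul_three_le_sq_mul {a b c q : ℝ} (ha : 0 ≤ a) (hb : 0 ≤ b) (hc : 0 ≤ c)
    (haq : a ≤ q) (hbq : b ≤ q) : a * b * c ≤ q ^ 2 * c := by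
  rw [sq]
  exact mul_le_mul_of_nonneg_right (mul_le_mul haq hbq hb (ha.trans haq)) hc

/-- If two of the three lags between consecutive times are at least `T`, a double collision has
probability at most `q ^ 2`; otherwise the excess is controlled by `pairExcess`. -/
theorem IsMarkovTraj.measureReal_pair_le_of_le (hmarkov : IsMarkovTraj μ P X)
    (hmeas : ∀ n, Measurable (X n)) {x₀ : S} (hstart : μ {ω | X 0 ω = x₀} = 1)
    (hP : P ∈ doublyStochastic ℝ S) {T : ℕ} {q : ℝ} (hq0 : 0 ≤ q)
    (hq : ∀ u v, (P ^ T) u v ≤ q) {i j k l : ℕ} (hij : i + 2 * T ≤ j) (hkl : k + 2 * T ≤ l)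
    (hik : i ≤ k) :
    μ.real {ω | X i ω = X j ω ∧ X k ω = X l ω} ≤ q ^ 2 + q * pairExcess P T x₀ i j k l := by
  have hnn : ∀ n u v, 0 ≤ (P ^ n) u v := fun n u v =>
    nonneg_of_mem_doublyStochastic (pow_mem hP n)
  have hle : ∀ n, T ≤ n → ∀ u v, (P ^ n) u v ≤ q := fun n hn => pow_apply_le_of_le hP hn hq
  have hr : ∀ n u, ∑ v, (P ^ n) u v = 1 := fun n =>
    sum_row_of_mem_doublyStochastic (pow_mem hP n)
  have hc : ∀ n u, ∑ v, (P ^ n) v u = 1 := fun n =>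
    sum_col_of_mem_doublyStochastic (pow_mem hP n)
  have hex := mul_nonneg hq0 (pairExcess_nonneg hP T x₀ i j k l)
  have hexcess : ∀ W : S → S → ℝ, (∀ u v, W u v ≤ q * (truncKernel P T i k u v *
      (truncKernel P T j l u v + truncKernel P T l j v u))) →
      ∑ u, (P ^ i) x₀ u * ∑ v, W u v ≤ q ^ 2 + q * pairExcess P T x₀ i j k l := by
    intro W hW
    refine le_add_of_nonneg_of_le (sq_nonneg q) ?_
    rw [pairExcess, Finset.mul_sum]
    refine Finset.sum_le_sum fun u _ => ?_
    rw [mul_left_comm, Finset.mul_sum _ _ q]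
    exact mul_le_mul_of_nonneg_left (Finset.sum_le_sum fun v _ => hW u v) (hnn ..)
  rcases le_total j k with hjk | hkj
  · rw [hmarkov.measureReal_pair_disjoint hmeas hstart (by omega) hjk (by omega)]
    refine le_add_of_le_of_nonneg (sum_mul_sum_le hP i x₀ (hr (k - j)) fun u v => ?_) hex
    rw [mul_right_comm]
    exact mul_three_le_sq_mul (hnn ..) (hnn ..) (hnn ..) (hle _ (by omega) ..)
      (hle _ (by omega) ..)
  rcases le_total j l with hjl | hlj
  · rw [hmarkov.measureReal_pair_interleaved hmeas hstart hik hkj hjl]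
    by_cases h₁ : T ≤ k - i
    · by_cases h₂ : T ≤ j - k
      · exact le_add_of_le_of_nonneg (sum_mul_sum_le hP i x₀ (hr (l - j)) fun u v =>
          mul_three_le_sq_mul (hnn ..) (hnn ..) (hnn ..) (hle _ h₁ ..) (hle _ h₂ ..)) hex
      · refine le_add_of_le_of_nonneg (sum_mul_sum_le hP i x₀ (hc (j - k)) fun u v => ?_) hex
        rw [mul_right_comm]
        exact mul_three_le_sq_mul (hnn ..) (hnn ..) (hnn ..) (hle _ h₁ ..)
          (hle _ (by omega) ..)
    · by_cases h₂ : T ≤ l - j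
      · refine le_add_of_le_of_nonneg (sum_mul_sum_le hP i x₀ (hr (k - i)) fun u v => ?_) hex
        rw [mul_assoc, mul_comm]
        exact mul_three_le_sq_mul (hnn ..) (hnn ..) (hnn ..) (hle _ (by omega) ..)
          (hle _ h₂ ..)
      · refine hexcess _ fun u v => ?_
        rw [show truncKernel P T i k u v = (P ^ (k - i)) u v from if_pos (by omega),
          show truncKernel P T j l u v = (P ^ (l - j)) u v from if_pos (by omega),
          mul_comm ((P ^ (k - i)) u v), mul_assoc]
        exact mul_le_mul (hle _ (by omega) ..) (mul_le_mul_of_nonneg_left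
          (le_add_of_nonneg_right (truncKernel_nonneg hP ..)) (hnn ..))
          (mul_nonneg (hnn ..) (hnn ..)) hq0
  · rw [hmarkov.measureReal_pair_nested hmeas hstart hik (by omega) hlj]
    have h₀ : T ≤ l - k := by omega
    by_cases h₁ : T ≤ k - i
    · exact le_add_of_le_of_nonneg (sum_mul_sum_le hP i x₀ (hc (j - l)) fun u v =>
        mul_three_le_sq_mul (hnn ..) (hnn ..) (hnn ..) (hle _ h₁ ..) (hle _ h₀ ..)) hex
    by_cases h₂ : T ≤ j - l
    · refine le_add_of_le_of_nonneg (sum_mul_sum_le hP i x₀ (hr (k - i)) fun u v => ?_) hex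
      rw [mul_assoc, mul_comm]
      exact mul_three_le_sq_mul (hnn ..) (hnn ..) (hnn ..) (hle _ h₀ ..) (hle _ h₂ ..)
    · refine hexcess _ fun u v => ?_
      rw [show truncKernel P T i k u v = (P ^ (k - i)) u v from if_pos (by omega),
        show truncKernel P T l j v u = (P ^ (j - l)) v u from if_pos (by omega),
        mul_comm ((P ^ (k - i)) u v), mul_assoc]
      exact mul_le_mul (hle _ h₀ ..) (mul_le_mul_of_nonneg_left
        (le_add_of_nonneg_left (truncKernel_nonneg hP ..)) (hnn ..))
        (mul_nonneg (hnn ..) (hnn ..)) hq0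

theorem IsMarkovTraj.measureReal_pair_le (hmarkov : IsMarkovTraj μ P X)
    (hmeas : ∀ n, Measurable (X n)) {x₀ : S} (hstart : μ {ω | X 0 ω = x₀} = 1)
    (hP : P ∈ doublyStochastic ℝ S) {T : ℕ} {q : ℝ} (hq0 : 0 ≤ q)
    (hq : ∀ u v, (P ^ T) u v ≤ q) {i j k l : ℕ} (hij : i + 2 * T ≤ j)
    (hkl : k + 2 * T ≤ l) :
    μ.real {ω | X i ω = X j ω ∧ X k ω = X l ω} ≤
      q ^ 2 + q * (pairExcess P T x₀ i j k l + pairExcess P T x₀ k l i j) := by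
  have h₁ := mul_nonneg hq0 (pairExcess_nonneg hP T x₀ i j k l)
  have h₂ := mul_nonneg hq0 (pairExcess_nonneg hP T x₀ k l i j)
  rw [mul_add]
  rcases le_total i k with h | h
  · linarith [hmarkov.measureReal_pair_le_of_le hmeas hstart hP hq0 hq hij hkl h]
  · have h₃ := hmarkov.measureReal_pair_le_of_le hmeas hstart hP hq0 hq hkl hij h
    simp only [and_comm] at h₃ ⊢
    linarith

end PairCollisions

section SecondMoment

variable {Ω ι : Type*} [MeasurableSpace Ω] {μ : Measure Ω} [IsProbabilityMeasure μ]

/-- The second moment method for a finite family of events. -/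
theorem sq_div_le_measureReal_exists (W : Finset ι) (E : ι → Set Ω)
    (hE : ∀ p, MeasurableSet (E p)) {a b : ℝ} (ha : 0 ≤ a) (hfirst : a ≤ ∑ p ∈ W, μ.real (E p))
    (hb : 0 < b) (hsecond : ∑ p ∈ W, ∑ p' ∈ W, μ.real (E p ∩ E p') ≤ b) :
    a ^ 2 / b ≤ μ.real {ω | ∃ p ∈ W, ω ∈ E p} := by
  have hint : ∀ s : Set Ω, MeasurableSet s → Integrable (s.indicator (1 : Ω → ℝ)) μ :=
    fun s hs => (integrable_const (1 : ℝ)).indicator hs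
  have hmeasU : MeasurableSet {ω | ∃ p ∈ W, ω ∈ E p} := by
    have h := Finset.measurableSet_biUnion W fun p _ => hE p
    convert h using 1
    ext ω
    simp
  set c := a / b
  have hpoint : ∀ ω, 2 * c * ∑ p ∈ W, (E p).indicator (1 : Ω → ℝ) ω -
      c ^ 2 * ∑ p ∈ W, ∑ p' ∈ W, (E p ∩ E p').indicator (1 : Ω → ℝ) ω ≤
      {ω | ∃ p ∈ W, ω ∈ E p}.indicator (1 : Ω → ℝ) ω := by
    intro ω
    simp only [Set.inter_indicator_one, Pi.mul_apply, ← Finset.mul_sum, ← Finset.sum_mul]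
    by_cases hω : ω ∈ {ω | ∃ p ∈ W, ω ∈ E p}
    · rw [Set.indicator_of_mem hω, Pi.one_apply]
      nlinarith [sq_nonneg (1 - c * ∑ p ∈ W, (E p).indicator (1 : Ω → ℝ) ω)]
    · rw [Set.indicator_of_notMem hω, Finset.sum_eq_zero fun p hp =>
        Set.indicator_of_notMem (fun h => hω ⟨p, hp, h⟩) _]
      simp
  have hint₁ : Integrable (fun ω => ∑ p ∈ W, (E p).indicator (1 : Ω → ℝ) ω) μ :=
    integrable_finsetSum _ fun p _ => hint _ (hE p)
  have hint₂ : Integrable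
      (fun ω => ∑ p ∈ W, ∑ p' ∈ W, (E p ∩ E p').indicator (1 : Ω → ℝ) ω) μ :=
    integrable_finsetSum _ fun p _ => integrable_finsetSum _ fun p' _ =>
      hint _ ((hE p).inter (hE p'))
  have h := integral_mono ((hint₁.const_mul (2 * c)).sub (hint₂.const_mul (c ^ 2)))
    (hint _ hmeasU) hpoint
  rw [integral_indicator_one hmeasU] at h
  refine le_trans ?_ h
  simp only [Pi.sub_apply]
  rw [integral_sub (hint₁.const_mul _) (hint₂.const_mul _), integral_const_mul,
    integral_const_mul, integral_finsetSum _ fun p _ => hint _ (hE p),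
    integral_finsetSum _ fun p _ => integrable_finsetSum _ fun p' _ =>
      hint _ ((hE p).inter (hE p'))]
  rw [Finset.sum_congr rfl fun p _ => integral_indicator_one (hE p),
    Finset.sum_congr rfl fun p _ => (integral_finsetSum W fun p' _ =>
      hint _ ((hE p).inter (hE p'))).trans
      (Finset.sum_congr rfl fun p' _ => integral_indicator_one ((hE p).inter (hE p')))]
  calc a ^ 2 / b = 2 * c * a - c ^ 2 * b := by
        simp only [c]
        field_simp
        ring
    _ ≤ _ := sub_le_sub (mul_le_mul_of_nonneg_left hfirst (by positivity))
        (mul_le_mul_of_nonneg_left hsecond (sq_nonneg c))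

end SecondMoment

section CollisionCount

/-- The index pairs over which `collCount` sums. -/
def collPairs (T L : ℕ) : Finset (Σ _ : ℕ, ℕ) :=
  (Finset.range (L + 1)).sigma fun i => Finset.Icc (i + 2 * T) (L + 2 * T)

theorem mem_collPairs {T L : ℕ} {p : Σ _ : ℕ, ℕ} :
    p ∈ collPairs T L ↔ p.1 ≤ L ∧ p.1 + 2 * T ≤ p.2 ∧ p.2 ≤ L + 2 * T := by
  simp [collPairs]

theorem two_mul_card_collPairs (T L : ℕ) :
    2 * (collPairs T L).card = (L + 1) * (L + 2) := by
  have h : (collPairs T L).card = ∑ i ∈ Finset.range (L + 1), (i + 1) := by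
    rw [collPairs, Finset.card_sigma, ← Finset.sum_range_reflect]
    refine Finset.sum_congr rfl fun i hi => ?_
    have := Finset.mem_range.1 hi
    rw [Nat.card_Icc]
    omega
  have h' := Finset.sum_range_id_mul_two (L + 2)
  rw [Finset.sum_range_succ'] at h'
  rw [h, mul_comm, show (L + 1) * (L + 2) = (L + 2) * (L + 2 - 1) by rw [mul_comm]; rfl, ← h']
  rfl

theorem collCount_pos_iff {S Ω : Type*} [DecidableEq S] {X : ℕ → Ω → S} {T L : ℕ} {ω : Ω} :
    0 < collCount X T L ω ↔ ∃ p ∈ collPairs T L, ω ∈ {ω | X p.1 ω = X p.2 ω} := by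
  have h : collCount X T L ω =
      ∑ p ∈ collPairs T L, if X p.1 ω = X p.2 ω then (1 : ℝ) else 0 := by
    rw [collPairs, Finset.sum_sigma, collCount]
  rw [h, Finset.sum_pos_iff_of_nonneg fun p _ => by split_ifs <;> norm_num]
  refine exists_congr fun p => and_congr_right fun _ => ?_
  by_cases hp : X p.1 ω = X p.2 ω <;> simp [hp]

theorem IsMarkovTraj.sum_measureReal_pair_le {S Ω : Type*} [Fintype S] [DecidableEq S]
    [MeasurableSpace S] [MeasurableSingletonClass S] [MeasurableSpace Ω] {μ : Measure Ω}
    [IsProbabilityMeasure μ] {P : Matrix S S ℝ} {X : ℕ → Ω → S} (hmarkov : IsMarkovTraj μ P X)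
    (hmeas : ∀ n, Measurable (X n)) {x₀ : S} (hstart : μ {ω | X 0 ω = x₀} = 1)
    (hP : P ∈ doublyStochastic ℝ S) {T : ℕ} {q : ℝ} (hq0 : 0 ≤ q)
    (hq : ∀ u v, (P ^ T) u v ≤ q) (L : ℕ) :
    ∑ p ∈ collPairs T L, ∑ p' ∈ collPairs T L,
        μ.real {ω | X p.1 ω = X p.2 ω ∧ X p'.1 ω = X p'.2 ω} ≤
      ((collPairs T L).card : ℝ) ^ 2 * q ^ 2 +
        q * (4 * (collPairs T L).card * max (Acoll P T) (AcollStar P T)) := by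
  have hexcess : ∑ p ∈ collPairs T L, ∑ p' ∈ collPairs T L,
      pairExcess P T x₀ p.1 p.2 p'.1 p'.2 ≤
      (collPairs T L).card * (2 * max (Acoll P T) (AcollStar P T)) := by
    rw [← nsmul_eq_mul]
    refine Finset.sum_le_card_nsmul _ _ _ fun p _ => ?_
    rw [collPairs, Finset.sum_sigma]
    exact sum_pairExcess_le hP T x₀ p.1 p.2 _ _
  calc _ ≤ ∑ p ∈ collPairs T L, ∑ p' ∈ collPairs T L, (q ^ 2 +
          q * (pairExcess P T x₀ p.1 p.2 p'.1 p'.2 + pairExcess P T x₀ p'.1 p'.2 p.1 p.2)) :=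
        Finset.sum_le_sum fun p hp => Finset.sum_le_sum fun p' hp' =>
          hmarkov.measureReal_pair_le hmeas hstart hP hq0 hq (mem_collPairs.1 hp).2.1
            (mem_collPairs.1 hp').2.1
    _ = ((collPairs T L).card : ℝ) ^ 2 * q ^ 2 + q * (2 * ∑ p ∈ collPairs T L,
          ∑ p' ∈ collPairs T L, pairExcess P T x₀ p.1 p.2 p'.1 p'.2) := by
        simp only [Finset.sum_add_distrib, ← Finset.mul_sum, Finset.sum_const, nsmul_eq_mul]
        have hswap : ∑ p ∈ collPairs T L, ∑ p' ∈ collPairs T L,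
            pairExcess P T x₀ p'.1 p'.2 p.1 p.2 = ∑ p ∈ collPairs T L, ∑ p' ∈ collPairs T L,
            pairExcess P T x₀ p.1 p.2 p'.1 p'.2 := Finset.sum_comm
        rw [hswap]
        ring
    _ ≤ _ := by
        refine add_le_add le_rfl (mul_le_mul_of_nonneg_left ?_ hq0)
        linarith

end CollisionCount

theorem positive_self_intersection_probability
    {S : Type*} [Fintype S] [DecidableEq S] [Nonempty S]
    [MeasurableSpace S] [MeasurableSingletonClass S]
    {Ω : Type*} [MeasurableSpace Ω] (μ : Measure Ω) [IsProbabilityMeasure μ]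
    (P : Matrix S S ℝ)
    (hnonneg : ∀ u v, 0 ≤ P u v)
    (hrow : ∀ u, ∑ v, P u v = 1)
    (hcol : ∀ v, ∑ u, P u v = 1)
    (hergodic : ∃ n : ℕ, ∀ u v, 0 < (P ^ n) u v)
    (N : ℕ) (hN : N = Fintype.card S)
    (T : ℕ) (m M : ℝ) (hm0 : 0 < m) (hm1 : m ≤ 1) (hM : 1 ≤ M)
    (hPT : ∀ u v, m / N ≤ (P ^ T) u v ∧ (P ^ T) u v ≤ M / N)
    (L : ℕ)
    (hL : 2 * Real.sqrt (2 * N / M * max (Acoll P T) (AcollStar P T)) ≤ L)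
    (x0 : S) (X : ℕ → Ω → S)
    (hmeas : ∀ n, Measurable (X n))
    (hstart : μ {ω | X 0 ω = x0} = 1)
    (hmarkov : IsMarkovTraj μ P X) :
    ENNReal.ofReal (m ^ 2 / (2 * M ^ 2)) ≤ μ {ω | 0 < collCount X T L ω} ∧
    ENNReal.ofReal (m ^ 2 / (2 * M ^ 2)) ≤
      μ {ω | ∃ i j, i < j ∧ j ≤ L + 2 * T ∧ X i ω = X j ω} := by
  have hP : P ∈ doublyStochastic ℝ S :=
    mem_doublyStochastic_iff_sum.2 ⟨hnonneg, hrow, hcol⟩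
  have hN0 : (0 : ℝ) < N := by
    rw [hN]
    exact_mod_cast Fintype.card_pos
  have hL1 : 1 ≤ L := by
    have h : 0 < Real.sqrt (2 * N / M * max (Acoll P T) (AcollStar P T)) :=
      Real.sqrt_pos.2 (mul_pos (by positivity) (lt_max_of_lt_left (acoll_pos hP T)))
    have : (0 : ℝ) < L := by linarith
    exact_mod_cast this
  have hbound : m ^ 2 / (2 * M ^ 2) ≤ μ.real {ω | 0 < collCount X T L ω} := by
    set A := max (Acoll P T) (AcollStar P T)
    set C : ℝ := ((collPairs T L).card : ℝ) with hC
    have hcard : (L : ℝ) ^ 2 ≤ 2 * C := by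
      have h := two_mul_card_collPairs T L
      have h' : (2 : ℝ) * C = (L + 1) * (L + 2) := by
        rw [hC]
        exact_mod_cast h
      nlinarith [(Nat.cast_nonneg L : (0 : ℝ) ≤ L)]
    have hC0 : 0 < C := by
      have : (1 : ℝ) ≤ L := by exact_mod_cast hL1
      nlinarith
    have hA : 4 * A ≤ M / N * C := by
      have h := (Real.sqrt_le_iff.1 (show Real.sqrt (2 * N / M * A) ≤ L / 2 by linarith)).2
      have hM0 : 0 < M / N := by positivity
      have h2 : M / N * (2 * N / M * A) = 2 * A := by
        field_simp
      have h3 := mul_le_mul_of_nonneg_left (h.trans (show ((L : ℝ) / 2) ^ 2 ≤ C / 2 by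
        nlinarith)) hM0.le
      rw [h2] at h3
      linarith
    have hfirst : C * (m / N) ≤
        ∑ p ∈ collPairs T L, μ.real {ω | X p.1 ω = X p.2 ω} := by
      rw [hC, ← nsmul_eq_mul]
      refine Finset.card_nsmul_le_sum _ _ _ fun p hp => ?_
      have := mem_collPairs.1 hp
      exact hmarkov.le_measureReal_collision hmeas hstart hP (fun u v => (hPT u v).1) (by omega)
    have hsecond := hmarkov.sum_measureReal_pair_le hmeas hstart hP
      (q := M / N) (by positivity) (fun u v => (hPT u v).2) L
    have hsecond' : ∑ p ∈ collPairs T L, ∑ p' ∈ collPairs T L,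
        μ.real {ω | X p.1 ω = X p.2 ω ∧ X p'.1 ω = X p'.2 ω} ≤ 2 * (M / N) ^ 2 * C ^ 2 := by
      refine hsecond.trans ?_
      have h := mul_le_mul_of_nonneg_left hA (show 0 ≤ M / N * C by positivity)
      change C ^ 2 * (M / N) ^ 2 + M / N * (4 * C * A) ≤ _
      nlinarith
    have h := sq_div_le_measureReal_exists (collPairs T L)
      (fun p => {ω | X p.1 ω = X p.2 ω})
      (fun p => measurableSet_eq_fun (hmeas _) (hmeas _)) (by positivity) hfirst
      (show 0 < 2 * (M / N) ^ 2 * C ^ 2 by positivity) hsecond'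
    simp only [collCount_pos_iff]
    refine le_trans (le_of_eq ?_) h
    field_simp
  have hfst : ENNReal.ofReal (m ^ 2 / (2 * M ^ 2)) ≤ μ {ω | 0 < collCount X T L ω} :=
    (ENNReal.ofReal_le_iff_le_toReal (measure_ne_top _ _)).2 hbound
  refine ⟨hfst, ?_⟩
  rcases Nat.eq_zero_or_pos T with rfl | hT
  · have hsub : ∀ u v : S, u = v := by
      intro u v
      by_contra huv
      have h := (hPT u v).1
      rw [pow_zero, Matrix.one_apply_ne huv] at h
      exact absurd h (not_le.2 (by positivity))
    refine hfst.trans (prob_le_one.trans_eq ?_)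
    rw [← measure_univ (μ := μ)]
    congr 1
    refine (Set.eq_univ_of_forall fun ω => ?_).symm
    exact ⟨0, 1, one_pos, by omega, hsub _ _⟩
  · refine hfst.trans (measure_mono fun ω hω => ?_)
    obtain ⟨p, hp, h⟩ := collCount_pos_iff.1 hω
    have := mem_collPairs.1 hp
    exact ⟨p.1, p.2, by omega, by omega, h⟩
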